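/- Let n ≥ 1 and 0 ≤ k ≤ n−1, let σ be a permutation of {1,…,n−k}, and let σ′ be the permutation of {1,…,n} defined by σ′(x) = σ(x) for 1 ≤ x ≤ n−k and σ′(x) = x for n−k < x ≤ n. Then F_{σ′}(z) = (n−1)(n−2)⋯(n−k)·F_σ(z), i.e., F_{σ′}(z) = ((n−1)!/(n−k−1)!)·F_σ(z). -/

import Mathlib

open Finset Polynomial

/-- Number of cycles of a permutation, counting fixed points as cycles of length 1
(equivalently, the number of orbits). -/
noncomputable def cycleCount {α : Type*} [Fintype α] [DecidableEq α] (σ : Equiv.Perm α) : ℕ :=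
  σ.cycleType.card + (Finset.univ.filter fun x => σ x = x).card

/-- The IO-polynomial `F_π(z) = Σ_{ζ ∈ Q_n} z^⌊(c(ζπ)-1)/2⌋`, where `Q_n` is the set of
`n`-cycles of `S_n` (i.e. permutations with a single cycle), and `ζπ` applies `ζ` first
and then `π`. -/
noncomputable def IOPoly {n : ℕ} (π : Equiv.Perm (Fin n)) : Polynomial ℝ :=
  ∑ ζ ∈ Finset.univ.filter (fun ζ : Equiv.Perm (Fin n) => cycleCount ζ = 1),
    Polynomial.X ^ ((cycleCount (π * ζ) - 1) / 2)

theorem Equiv.Perm.SameCycle.of_equivalence {α : Type*} {σ : Equiv.Perm α} {r : α → α → Prop}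
    (hr : Equivalence r) (h : ∀ x, r x (σ x)) {x y : α} (hxy : σ.SameCycle x y) : r x y := by
  have hpow : ∀ (m : ℕ) (z : α), r z ((σ ^ m) z) := by
    intro m
    induction m with
    | zero => exact hr.refl
    | succ m ih =>
      intro z
      rw [pow_succ']
      exact hr.trans (ih z) (h _)
  obtain ⟨i, rfl⟩ := hxy
  obtain ⟨m, rfl | rfl⟩ := i.eq_nat_or_neg
  · simpa using hpow m x
  · have := hpow m ((σ ^ (-(m : ℤ))) x)
    rw [← Equiv.Perm.mul_apply, ← zpow_natCast, ← zpow_add, add_neg_cancel, zpow_zero] at this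
    exact hr.symm this

section

variable {α β : Type*} [Fintype α] [DecidableEq α] [Fintype β] [DecidableEq β]

theorem cycleCount_eq_card_quotient (σ : Equiv.Perm α) :
    cycleCount σ = Nat.card (Quotient (Equiv.Perm.SameCycle.setoid σ)) := by
  classical
  let g : α → α ⊕ Equiv.Perm α := fun x => if σ x = x then .inl x else .inr (σ.cycleOf x)
  have hker : Equiv.Perm.SameCycle.setoid σ = Setoid.ker g := by
    ext x y
    change σ.SameCycle x y ↔ g x = g y
    by_cases hx : σ x = x
    · by_cases hy : σ y = y
      · simp only [g, hx, hy, if_true, Sum.inl.injEq]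
        exact ⟨fun h => h.eq_of_left hx, fun h => h ▸ .refl _ _⟩
      · simp only [g, hx, hy, if_true, if_false, reduceCtorEq, iff_false]
        intro h
        exact hy (h.eq_of_left hx ▸ hx)
    · by_cases hy : σ y = y
      · simp only [g, hx, hy, if_true, if_false, reduceCtorEq, iff_false]
        intro h
        exact hx (h.symm.eq_of_left hy ▸ hy)
      · simp only [g, hx, hy, if_false, Sum.inr.injEq]
        exact Equiv.Perm.sameCycle_iff_cycleOf_eq_of_mem_support
          (Equiv.Perm.mem_support.2 hx) (Equiv.Perm.mem_support.2 hy)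
  have hrange : Set.range g =
      ((univ.filter fun x => σ x = x).disjSum σ.cycleFactorsFinset : Finset _) := by
    ext (a | c)
    · simp only [Set.mem_range, mem_coe, inl_mem_disjSum, mem_filter, mem_univ, true_and, g]
      constructor
      · rintro ⟨x, hx⟩
        split_ifs at hx with h
        · cases hx
          exact h
      · exact fun h => ⟨a, if_pos h⟩
    · simp only [Set.mem_range, mem_coe, inr_mem_disjSum, g]
      constructor
      · rintro ⟨x, hx⟩
        split_ifs at hx with h
        · cases hx
          exact Equiv.Perm.cycleOf_mem_cycleFactorsFinset_iff.2 (Equiv.Perm.mem_support.2 h)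
      · intro hc
        obtain ⟨x, hx⟩ := (Equiv.Perm.mem_cycleFactorsFinset_iff.1 hc).1.nonempty_support
        have hxσ := Equiv.Perm.mem_support.1 (Equiv.Perm.mem_cycleFactorsFinset_support_le hc hx)
        exact ⟨x, by rw [if_neg hxσ, ← Equiv.Perm.cycle_is_cycleOf hx hc]⟩
  rw [hker, Nat.card_congr (Setoid.quotientKerEquivRange g), hrange, Nat.card_coe_set_eq,
    Set.ncard_coe_finset, card_disjSum, cycleCount, Equiv.Perm.cycleType_def, Multiset.card_map,
    add_comm]
  rfl

theorem cycleCount_eq_of_sameCycle_iff {σ : Equiv.Perm α} {ρ : Equiv.Perm β} (f : α → β)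
    (hf : ∀ x y, σ.SameCycle x y ↔ ρ.SameCycle (f x) (f y))
    (hsurj : ∀ z, ∃ x, ρ.SameCycle (f x) z) : cycleCount σ = cycleCount ρ := by
  rw [cycleCount_eq_card_quotient, cycleCount_eq_card_quotient]
  refine Nat.card_eq_of_bijective
    (Quotient.map' (s₁ := Equiv.Perm.SameCycle.setoid σ) (s₂ := Equiv.Perm.SameCycle.setoid ρ)
      f fun x y h => (hf x y).1 h) ⟨?_, ?_⟩
  · rintro ⟨x⟩ ⟨y⟩ h
    exact Quotient.sound ((hf x y).2 (Quotient.exact h))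
  · rintro ⟨z⟩
    obtain ⟨x, hx⟩ := hsurj z
    exact ⟨Quotient.mk _ x, Quotient.sound hx⟩

theorem cycleCount_permCongr (e : α ≃ β) (σ : Equiv.Perm α) :
    cycleCount (e.permCongr σ) = cycleCount σ := by
  refine (cycleCount_eq_of_sameCycle_iff e (fun x y => ⟨?_, ?_⟩)
    fun z => ⟨e.symm z, by simp [Equiv.Perm.SameCycle.refl]⟩).symm
  · refine Equiv.Perm.SameCycle.of_equivalence (r := fun x y => (e.permCongr σ).SameCycle (e x) (e y))
      ⟨fun _ => .refl _ _, .symm, .trans⟩ fun x => ⟨1, by simp⟩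
  · intro h
    simpa using h.of_equivalence (r := fun x y => σ.SameCycle (e.symm x) (e.symm y))
      ⟨fun _ => .refl _ _, .symm, .trans⟩ fun x => ⟨1, by simp⟩

theorem cycleCount_swap_none_some_mul_optionCongr (a : α) (σ : Equiv.Perm α) :
    cycleCount (Equiv.swap none (some a) * Equiv.optionCongr σ) = cycleCount σ := by
  set ρ : Equiv.Perm (Option α) := Equiv.swap none (some a) * Equiv.optionCongr σ
  have hnone : ρ none = some a := by simp [ρ]
  have hsome : ∀ x, σ x ≠ a → ρ (some x) = some (σ x) := fun x hx => by
    simp [ρ, Equiv.swap_apply_of_ne_of_ne, hx]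
  have hsome' : ∀ x, σ x = a → ρ (some x) = none := fun x hx => by simp [ρ, hx]
  refine (cycleCount_eq_of_sameCycle_iff some (fun x y => ⟨?_, ?_⟩) ?_).symm
  · refine Equiv.Perm.SameCycle.of_equivalence (r := fun x y => ρ.SameCycle (some x) (some y))
      ⟨fun _ => .refl _ _, .symm, .trans⟩ fun x => ?_
    by_cases hx : σ x = a
    · exact ⟨2, by rw [zpow_ofNat, pow_two, Equiv.Perm.mul_apply, hsome' x hx, hnone, hx]⟩
    · exact ⟨1, by rw [zpow_one, hsome x hx]⟩
  · intro h
    refine h.of_equivalence (r := fun u v => σ.SameCycle (u.getD a) (v.getD a))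
      ⟨fun _ => .refl _ _, .symm, .trans⟩ ?_
    rintro (_ | x)
    · rw [hnone]
      exact .refl _ _
    · by_cases hx : σ x = a
      · rw [hsome' x hx]
        exact ⟨1, hx⟩
      · rw [hsome x hx]
        exact ⟨1, rfl⟩
  · rintro (_ | x)
    · exact ⟨a, -1, by rw [zpow_neg_one, Equiv.Perm.inv_eq_iff_eq, hnone]⟩
    · exact ⟨x, .refl _ _⟩

theorem cycleCount_optionCongr_ne_one [Nonempty α] (σ : Equiv.Perm α) :
    cycleCount (Equiv.optionCongr σ) ≠ 1 := by
  rw [cycleCount_eq_card_quotient]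
  intro h
  have := (Nat.card_eq_one_iff_unique.1 h).1
  obtain ⟨x⟩ := ‹Nonempty α›
  have hx : Equiv.Perm.SameCycle (Equiv.optionCongr σ) none (some x) :=
    Quotient.exact (Subsingleton.elim (Quotient.mk (Equiv.Perm.SameCycle.setoid _) none)
      (Quotient.mk _ (some x)))
  exact absurd (hx.eq_of_left (by simp [Function.IsFixedPt])) (by simp)

theorem sum_cycleCount_optionCongr [Nonempty α] {M : Type*} [AddCommMonoid M] (f : ℕ → M)
    (π : Equiv.Perm α) :
    ∑ ζ : Equiv.Perm (Option α) with cycleCount ζ = 1,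
        f (cycleCount (Equiv.optionCongr π * ζ : Equiv.Perm (Option α))) =
      Fintype.card α • ∑ ζ : Equiv.Perm α with cycleCount ζ = 1, f (cycleCount (π * ζ)) := by
  rw [sum_filter, ← Equiv.Perm.decomposeOption.symm.sum_comp, Fintype.sum_prod_type,
    Fintype.sum_option, sum_filter]
  have hmul : ∀ (a : α) (ζ : Equiv.Perm α),
      (Equiv.optionCongr π * (Equiv.swap none (some a) * Equiv.optionCongr ζ) :
        Equiv.Perm (Option α)) =
      Equiv.swap none (some (π a)) * Equiv.optionCongr (π * ζ) := by
    intro a ζ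
    rw [← mul_assoc, Equiv.mul_swap_eq_swap_mul, mul_assoc]
    simp only [Equiv.optionCongr_apply, Option.map_none, Option.map_some]
    congr 1
    ext x : 1
    cases x <;> simp
  simp [Equiv.swap_self, ← Equiv.Perm.one_def, cycleCount_optionCongr_ne_one, hmul,
    cycleCount_swap_none_some_mul_optionCongr]

end

theorem IOPoly_permCongr_optionCongr {m : ℕ} (hm : 1 ≤ m) (π : Equiv.Perm (Fin m)) :
    IOPoly (finSuccEquivLast.symm.permCongr (Equiv.optionCongr π)) = m • IOPoly π := by
  have : Nonempty (Fin m) := ⟨⟨0, hm⟩⟩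
  have h := sum_cycleCount_optionCongr (fun c => (X : ℝ[X]) ^ ((c - 1) / 2)) π
  rw [Fintype.card_fin] at h
  rw [IOPoly, IOPoly, ← h, sum_filter, sum_filter,
    ← (finSuccEquivLast (n := m)).symm.permCongr.sum_comp]
  refine sum_congr rfl fun ζ _ => ?_
  rw [← Equiv.permCongr_mul, cycleCount_permCongr, cycleCount_permCongr]

theorem IOPoly_eq_prod_Ico_smul {n : ℕ} (k : ℕ) : ∀ {m : ℕ} (_ : 1 ≤ m) (hmn : m ≤ n)
    (_ : n = m + k) (σ : Equiv.Perm (Fin m)) (σ' : Equiv.Perm (Fin n))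
    (_ : ∀ x : Fin m, σ' (Fin.castLE hmn x) = Fin.castLE hmn (σ x))
    (_ : ∀ x : Fin n, m ≤ (x : ℕ) → σ' x = x),
    IOPoly σ' = (∏ i ∈ Finset.Ico m n, i) • IOPoly σ := by
  induction k with
  | zero =>
    rintro m - hmn rfl σ σ' hext -
    have : σ' = σ := Equiv.ext fun x => hext x
    simp [this]
  | succ k ih =>
    intro m hm hmn hn σ σ' hext hfix
    have hlt : m < n := by omega
    rw [ih (Nat.le_add_left 1 m) hlt (by omega)
      (finSuccEquivLast.symm.permCongr (Equiv.optionCongr σ)) σ' ?_ fun x hx => hfix x (by omega),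
      IOPoly_permCongr_optionCongr hm, smul_smul, mul_comm, prod_eq_prod_Ico_succ_bot hlt (fun i => i)]
    intro x
    induction x using Fin.lastCases with
    | last => simpa using hfix (Fin.castLE hlt (Fin.last m)) le_rfl
    | cast x => simpa using hext x

/-- If `σ'` is obtained from `σ ∈ S_{n-k}` by adding the letters `n-k+1, …, n` as fixed
points, then `F_{σ'}(z) = (n-1)(n-2)⋯(n-k)·F_σ(z)`. -/
theorem stmt_1 (n k : ℕ) (hn : 1 ≤ n) (hk : k ≤ n - 1)
    (σ : Equiv.Perm (Fin (n - k))) (σ' : Equiv.Perm (Fin n))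
    (hext : ∀ x : Fin (n - k),
      σ' (Fin.castLE (Nat.sub_le n k) x) = Fin.castLE (Nat.sub_le n k) (σ x))
    (hfix : ∀ x : Fin n, n - k ≤ (x : ℕ) → σ' x = x) :
    IOPoly σ' = (∏ i ∈ Finset.Ico (n - k) n, i) • IOPoly σ := by
  exact IOPoly_eq_prod_Ico_smul k (by omega) (Nat.sub_le n k) (by omega) σ σ' hext hfix
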